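/- arXiv:1403.5527 — 3 statements merged into one kernel-verified Lean document; each statement's English description precedes it below -/
import Mathlib

section
/- Let 𝔥 = 𝔥₀ ⊕ 𝔥₁ be an orthogonal decomposition of a finite-dimensional complex Hilbert space, let A₀ ∈ L(𝔥₀) and A₁ ∈ L(𝔥₁) be self-adjoint, V ∈ L(𝔥₁, 𝔥₀), and let B = [[A₀, V], [V*, A₁]] be the self-adjoint block operator on 𝔥. If the spectra of B and of A₀ are disjoint, then there exists at least one bounded solution X ∈ L(𝔥₀, 𝔥₁) to the operator Riccati equation A₁X − XA₀ − XVX + V* = 0. -/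
open MeasureTheory Filter Topology Complex
open scoped InnerProductSpace ComplexOrder

noncomputable section

/-- A self-adjoint block operator is symmetric. -/
theorem isSymmetric_blockOperator {H0 H1 : Type*}
    [NormedAddCommGroup H0] [InnerProductSpace ℂ H0] [CompleteSpace H0]
    [NormedAddCommGroup H1] [InnerProductSpace ℂ H1] [CompleteSpace H1]
    {A0 : H0 →L[ℂ] H0} {A1 : H1 →L[ℂ] H1} {V : H1 →L[ℂ] H0}
    (hA0 : IsSelfAdjoint A0) (hA1 : IsSelfAdjoint A1)
    {B : WithLp 2 (H0 × H1) →ₗ[ℂ] WithLp 2 (H0 × H1)}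
    (hB : ∀ x, B x = WithLp.toLp 2
      (A0 x.fst + V x.snd, ContinuousLinearMap.adjoint V x.fst + A1 x.snd)) :
    B.IsSymmetric := by
  intro x y
  have h0 : ⟪A0 x.fst, y.fst⟫_ℂ = ⟪x.fst, A0 y.fst⟫_ℂ := hA0.isSymmetric _ _
  have h1 : ⟪A1 x.snd, y.snd⟫_ℂ = ⟪x.snd, A1 y.snd⟫_ℂ := hA1.isSymmetric _ _
  rw [hB, hB]
  change ⟪A0 x.fst + V x.snd, y.fst⟫_ℂ + ⟪ContinuousLinearMap.adjoint V x.fst + A1 x.snd, y.snd⟫_ℂ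
    = ⟪x.fst, A0 y.fst + V y.snd⟫_ℂ + ⟪x.snd, ContinuousLinearMap.adjoint V y.fst + A1 y.snd⟫_ℂ
  simp only [inner_add_left, inner_add_right, h0, h1,
    ContinuousLinearMap.adjoint_inner_left, ContinuousLinearMap.adjoint_inner_right]
  ring

/-- If vectors `u i` span `E` and `f : E → F` is a surjective linear map, then some of the
`f (u i)` form a basis of `F`. -/
theorem exists_basis_map_of_span_eq_top {K E F ι : Type*} [Field K]
    [AddCommGroup E] [Module K E] [AddCommGroup F] [Module K F]
    {u : ι → E} (hu : Submodule.span K (Set.range u) = ⊤)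
    {f : E →ₗ[K] F} (hf : Function.Surjective f) :
    ∃ (κ : Set F) (b : Module.Basis κ K F) (σ : κ → ι), ∀ k, b k = f (u (σ k)) := by
  have hs : ⊤ ≤ Submodule.span K (Set.range (f ∘ u)) := by
    rw [Set.range_comp, Submodule.span_image, hu, Submodule.map_top, LinearMap.range_eq_top.2 hf]
  have hmem (k) : ∃ i, f (u i) = Module.Basis.ofSpan hs k :=
    Module.Basis.ofSpan_subset hs ⟨k, rfl⟩
  choose σ hσ using hmem
  exact ⟨_, Module.Basis.ofSpan hs, σ, fun k => (hσ k).symm⟩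

/-- Let `𝔥 = 𝔥₀ ⊕ 𝔥₁` be a finite-dimensional complex Hilbert space,
`A₀, A₁` self-adjoint, `V ∈ L(𝔥₁, 𝔥₀)`, and `B = [[A₀, V], [V*, A₁]]`.  If the spectra
of `B` and `A₀` are disjoint, then the operator Riccati equation
`A₁X − XA₀ − XVX + V* = 0` has at least one bounded solution `X ∈ L(𝔥₀, 𝔥₁)`. -/
theorem statement3 {H0 H1 : Type u}
    [NormedAddCommGroup H0] [InnerProductSpace ℂ H0] [FiniteDimensional ℂ H0]
    [NormedAddCommGroup H1] [InnerProductSpace ℂ H1] [FiniteDimensional ℂ H1]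
    (A0 : H0 →L[ℂ] H0) (A1 : H1 →L[ℂ] H1) (V : H1 →L[ℂ] H0)
    (hA0 : IsSelfAdjoint A0) (hA1 : IsSelfAdjoint A1)
    (B : WithLp 2 (H0 × H1) →L[ℂ] WithLp 2 (H0 × H1))
    (hB : ∀ x : WithLp 2 (H0 × H1),
      B x = (WithLp.equiv 2 (H0 × H1)).symm
        (A0 ((WithLp.equiv 2 (H0 × H1)) x).1 + V ((WithLp.equiv 2 (H0 × H1)) x).2,
         (ContinuousLinearMap.adjoint V) ((WithLp.equiv 2 (H0 × H1)) x).1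
           + A1 ((WithLp.equiv 2 (H0 × H1)) x).2))
    (hdisj : spectrum ℂ B ∩ spectrum ℂ A0 = ∅) :
    ∃ X : H0 →L[ℂ] H1,
      (A1.comp X) - (X.comp A0) - (X.comp (V.comp X)) + ContinuousLinearMap.adjoint V = 0 := by
  have hB' : ∀ x : WithLp 2 (H0 × H1), B x = WithLp.toLp 2
      (A0 x.fst + V x.snd, ContinuousLinearMap.adjoint V x.fst + A1 x.snd) := hB
  have hsymm : (B : WithLp 2 (H0 × H1) →ₗ[ℂ] WithLp 2 (H0 × H1)).IsSymmetric :=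
    isSymmetric_blockOperator hA0 hA1 hB'
  let u := hsymm.eigenvectorBasis rfl
  have hu : Submodule.span ℂ (Set.range u) = ⊤ := by
    simpa using u.toBasis.span_eq
  obtain ⟨κ, b, σ, hb⟩ := exists_basis_map_of_span_eq_top hu
    (f := LinearMap.fst ℂ H0 H1 ∘ₗ (WithLp.linearEquiv 2 ℂ (H0 × H1)).toLinearMap)
    (fun x => ⟨WithLp.toLp 2 (x, 0), rfl⟩)
  let X : H0 →L[ℂ] H1 := LinearMap.toContinuousLinearMap (b.constr ℂ fun k => (u (σ k)).snd)
  have hX (k) : X (b k) = (u (σ k)).snd := b.constr_basis ℂ _ k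
  refine ⟨X, ContinuousLinearMap.coe_injective (b.ext fun k => ?_)⟩
  have hbk : b k = (u (σ k)).fst := hb k
  have heig := (hB' (u (σ k))).symm.trans (hsymm.apply_eigenvectorBasis rfl (σ k))
  have h0 := congrArg WithLp.fst heig
  have h1 := congrArg WithLp.snd heig
  change A0 (u (σ k)).fst + V (u (σ k)).snd = _ • (u (σ k)).fst at h0
  change ContinuousLinearMap.adjoint V (u (σ k)).fst + A1 (u (σ k)).snd
    = _ • (u (σ k)).snd at h1
  rw [← hbk, ← hX] at h0 h1
  have h2 := congrArg X h0
  rw [map_add, map_smul, ← h1] at h2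
  change A1 (X (b k)) - X (A0 (b k)) - X (V (X (b k))) + ContinuousLinearMap.adjoint V (b k) = 0
  rw [sub_sub, h2]
  abel
end
end

section
/- Let Ω : 𝓑(ℝ) → ℂ^{n×n} be a matrix-valued measure with Ω(Δ) ≥ 0 (positive semidefinite) for all Borel sets Δ ⊂ ℝ, and let M(z) = ∫_ℝ (t − z)^{-1} dΩ(t) for z in the upper half-plane ℂ₊. Then the set S_{Ω,s} := { λ ∈ ℝ : lim_{ε→0⁺} trace Im M(λ + iε) = ∞ } is a minimal support of the singular part Ω_s of Ω with respect to Lebesgue measure. -/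
open MeasureTheory Filter Topology Complex
open scoped InnerProductSpace ComplexOrder

noncomputable section

/-- The Poisson kernel of the upper half-plane, without the factor `π⁻¹`. -/
def upperPoissonKernel (ε x : ℝ) : ℝ := ε / (x ^ 2 + ε ^ 2)

/-- The boundary points of the upper half-plane at which the imaginary part of the Stieltjes
transform of `ω` tends to infinity along the vertical direction. -/
def stieltjesBlowUpSet (ω : Measure ℝ) : Set ℝ :=
  {l : ℝ | Tendsto (fun ε : ℝ => (∫ t, ((t : ℂ) - ((l : ℂ) + ε * Complex.I))⁻¹ ∂ω).im)
    (𝓝[>] 0) atTop}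

theorem im_stieltjesKernel (t l ε : ℝ) :
    (((t : ℂ) - ((l : ℂ) + ε * Complex.I))⁻¹).im = upperPoissonKernel ε (t - l) := by
  simp [Complex.inv_im, Complex.normSq_apply, upperPoissonKernel, pow_two]

theorem continuous_upperPoissonKernel {ε : ℝ} (hε : 0 < ε) :
    Continuous (upperPoissonKernel ε) := by
  unfold upperPoissonKernel
  exact continuous_const.div (by fun_prop) fun x => by positivity

theorem measurable_upperPoissonKernel (ε : ℝ) : Measurable (upperPoissonKernel ε) := by
  unfold upperPoissonKernel
  fun_prop

theorem upperPoissonKernel_nonneg {ε : ℝ} (hε : 0 < ε) (x : ℝ) :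
    0 ≤ upperPoissonKernel ε x := by
  unfold upperPoissonKernel
  positivity

theorem upperPoissonKernel_le {ε : ℝ} (hε : 0 < ε) (x : ℝ) :
    upperPoissonKernel ε x ≤ 1 / ε := by
  unfold upperPoissonKernel
  rw [div_le_div_iff₀ (by positivity) hε]
  nlinarith [sq_nonneg x]

theorem norm_upperPoissonKernel_le {ε : ℝ} (hε : 0 < ε) (x : ℝ) :
    ‖upperPoissonKernel ε x‖ ≤ 1 / ε := by
  rw [Real.norm_of_nonneg (upperPoissonKernel_nonneg hε x)]
  exact upperPoissonKernel_le hε x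

theorem le_upperPoissonKernel {ε x : ℝ} (hε : 0 < ε) (hx : |x| ≤ ε) :
    (2 * ε)⁻¹ ≤ upperPoissonKernel ε x := by
  unfold upperPoissonKernel
  rw [inv_eq_one_div, div_le_div_iff₀ (by positivity) (by positivity)]
  nlinarith [sq_le_sq' (abs_le.1 hx).1 (abs_le.1 hx).2]

theorem integrable_upperPoissonKernel_sub (ω : Measure ℝ) [IsFiniteMeasure ω] {ε : ℝ}
    (hε : 0 < ε) (l : ℝ) : Integrable (fun t => upperPoissonKernel ε (t - l)) ω :=
  .of_bound (((measurable_upperPoissonKernel ε).comp (by fun_prop)).aestronglyMeasurable) (1 / ε)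
    (ae_of_all _ fun _ => norm_upperPoissonKernel_le hε _)

theorem integrable_stieltjesKernel (ω : Measure ℝ) [IsFiniteMeasure ω] {ε : ℝ}
    (hε : 0 < ε) (l : ℝ) :
    Integrable (fun t : ℝ => ((t : ℂ) - ((l : ℂ) + ε * Complex.I))⁻¹) ω := by
  refine .of_bound (by fun_prop) ε⁻¹ (ae_of_all _ fun t => ?_)
  rw [norm_inv]
  refine inv_anti₀ hε ?_
  have h := Complex.abs_im_le_norm ((t : ℂ) - ((l : ℂ) + ε * Complex.I))
  simpa [abs_of_pos hε] using h

theorem im_stieltjes_eq_integral (ω : Measure ℝ) [IsFiniteMeasure ω] {ε : ℝ}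
    (hε : 0 < ε) (l : ℝ) :
    (∫ t, ((t : ℂ) - ((l : ℂ) + ε * Complex.I))⁻¹ ∂ω).im =
      ∫ t, upperPoissonKernel ε (t - l) ∂ω := by
  have h := integral_im (𝕜 := ℂ) (integrable_stieltjesKernel ω hε l)
  simp only [RCLike.im_to_complex, im_stieltjesKernel] at h
  exact h.symm

theorem mem_stieltjesBlowUpSet_iff (ω : Measure ℝ) [IsFiniteMeasure ω] (l : ℝ) :
    l ∈ stieltjesBlowUpSet ω ↔
      Tendsto (fun ε => ∫ t, upperPoissonKernel ε (t - l) ∂ω) (𝓝[>] 0) atTop :=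
  tendsto_congr' <| by
    filter_upwards [self_mem_nhdsWithin] with ε hε using im_stieltjes_eq_integral ω hε l

theorem continuous_integral_upperPoissonKernel (ω : Measure ℝ) [IsFiniteMeasure ω] {ε : ℝ}
    (hε : 0 < ε) : Continuous fun l => ∫ t, upperPoissonKernel ε (t - l) ∂ω :=
  continuous_of_dominated (bound := fun _ => 1 / ε)
    (fun l => (integrable_upperPoissonKernel_sub ω hε l).aestronglyMeasurable)
    (fun _ => ae_of_all _ fun _ => norm_upperPoissonKernel_le hε _) (integrable_const _)
    (ae_of_all _ fun t => (continuous_upperPoissonKernel hε).comp (by fun_prop))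

theorem measurableSet_stieltjesBlowUpSet (ω : Measure ℝ) [IsFiniteMeasure ω] :
    MeasurableSet (stieltjesBlowUpSet ω) := by
  have h : stieltjesBlowUpSet ω = ⋂ k : ℕ, ⋃ m : ℕ, ⋂ ε ∈ Set.Ioo (0 : ℝ) (1 / ((m : ℝ) + 1)),
      {l | (k : ℝ) ≤ ∫ t, upperPoissonKernel ε (t - l) ∂ω} := by
    ext l
    rw [mem_stieltjesBlowUpSet_iff]
    simp only [Set.mem_iInter, Set.mem_iUnion, Set.mem_ofPred_eq, tendsto_atTop]
    constructor
    · intro H k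
      obtain ⟨u, hu, hu'⟩ := mem_nhdsGT_iff_exists_Ioo_subset.1 (H k)
      obtain ⟨m, hm⟩ := exists_nat_one_div_lt (Set.mem_Ioi.1 hu)
      exact ⟨m, fun ε hε => hu' ⟨hε.1, hε.2.trans hm⟩⟩
    · intro H b
      obtain ⟨k, hk⟩ := exists_nat_ge b
      obtain ⟨m, hm⟩ := H k
      filter_upwards [Ioo_mem_nhdsGT (Nat.one_div_pos_of_nat (α := ℝ) (n := m))] with ε hε
      exact hk.trans (hm ε hε)
  rw [h]
  refine .iInter fun k => .iUnion fun m => IsClosed.measurableSet ?_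
  exact isClosed_biInter fun ε hε =>
    isClosed_le continuous_const (continuous_integral_upperPoissonKernel ω hε.1)

theorem lintegral_upperPoissonKernel {ε : ℝ} (hε : 0 < ε) (t : ℝ) :
    ∫⁻ l, ENNReal.ofReal (upperPoissonKernel ε (t - l)) = ENNReal.ofReal Real.pi := by
  lift ε to NNReal using hε.le
  have hε' : ε ≠ 0 := by rintro rfl; simp at hε
  have h (l : ℝ) : ENNReal.ofReal (upperPoissonKernel ε (t - l)) =
      ENNReal.ofReal Real.pi * ProbabilityTheory.cauchyPDF t ε l := by
    rw [ProbabilityTheory.cauchyPDF_def, ← ENNReal.ofReal_mul Real.pi_pos.le,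
      ProbabilityTheory.cauchyPDFReal_def, upperPoissonKernel]
    congr 1
    rw [show (t - l) ^ 2 = (l - t) ^ 2 by ring]
    field_simp
  simp_rw [h]
  rw [lintegral_const_mul _ (by fun_prop), ProbabilityTheory.lintegral_cauchyPDF_eq_one _ hε',
    mul_one]

theorem volume_stieltjesBlowUpSet (ω : Measure ℝ) [IsFiniteMeasure ω] :
    volume (stieltjesBlowUpSet ω) = 0 := by
  set F : ℝ → ℝ → ENNReal := fun ε l => ∫⁻ t, ENNReal.ofReal (upperPoissonKernel ε (t - l)) ∂ω
  have hmeas₂ (ε : ℝ) :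
      Measurable fun p : ℝ × ℝ => ENNReal.ofReal (upperPoissonKernel ε (p.2 - p.1)) :=
    ((measurable_upperPoissonKernel ε).comp (by fun_prop)).ennreal_ofReal
  have hmeas (ε : ℝ) : Measurable (F ε) := (hmeas₂ ε).lintegral_prod_right'
  have hint {ε : ℝ} (hε : 0 < ε) : ∫⁻ l, F ε l = ENNReal.ofReal Real.pi * ω Set.univ := by
    rw [lintegral_lintegral_swap (hmeas₂ ε).aemeasurable]
    simp_rw [lintegral_upperPoissonKernel hε]
    simp
  obtain ⟨u, -, hu0, hu⟩ := exists_seq_strictAnti_tendsto (0 : ℝ)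
  have hfatou := lintegral_liminf_le (μ := volume) (u := atTop) fun k => hmeas (u k)
  simp_rw [hint (hu0 _), liminf_const] at hfatou
  have hne : ∫⁻ l, liminf (fun k => F (u k) l) atTop ≠ ⊤ :=
    (hfatou.trans_lt (ENNReal.mul_lt_top ENNReal.ofReal_lt_top (measure_lt_top _ _))).ne
  have hae := ae_lt_top (Measurable.liminf fun k => hmeas (u k)) hne
  refine measure_mono_null (fun l hl => ?_) hae
  rw [mem_stieltjesBlowUpSet_iff] at hl
  have hF : Tendsto (fun k => F (u k) l) atTop (𝓝 ⊤) := by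
    refine (ENNReal.tendsto_ofReal_atTop.comp (hl.comp
      (tendsto_nhdsWithin_iff.2 ⟨hu, Eventually.of_forall hu0⟩))).congr fun k => ?_
    exact ofReal_integral_eq_lintegral_ofReal (integrable_upperPoissonKernel_sub ω (hu0 k) l)
      (ae_of_all _ fun t => upperPoissonKernel_nonneg (hu0 k) _)
  simp [hF.liminf_eq]

theorem measure_closedBall_div_le_integral (ω : Measure ℝ) [IsFiniteMeasure ω] {ε : ℝ}
    (hε : 0 < ε) (l : ℝ) :
    ω.real (Metric.closedBall l ε) / (2 * ε) ≤ ∫ t, upperPoissonKernel ε (t - l) ∂ω := by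
  calc ω.real (Metric.closedBall l ε) / (2 * ε)
      = ∫ t in Metric.closedBall l ε, (2 * ε)⁻¹ ∂ω := by simp [div_eq_mul_inv]
    _ ≤ ∫ t in Metric.closedBall l ε, upperPoissonKernel ε (t - l) ∂ω :=
      setIntegral_mono_on (integrable_const _)
        (integrable_upperPoissonKernel_sub ω hε l).integrableOn
        Metric.isClosed_closedBall.measurableSet fun t ht =>
          le_upperPoissonKernel hε (by simpa [Real.dist_eq] using ht)
    _ ≤ ∫ t, upperPoissonKernel ε (t - l) ∂ω :=
      setIntegral_le_integral (integrable_upperPoissonKernel_sub ω hε l)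
        (ae_of_all _ fun t => upperPoissonKernel_nonneg hε _)

theorem measure_sdiff_stieltjesBlowUpSet (ω : Measure ℝ) [IsFiniteMeasure ω]
    {N : Set ℝ} (hN : MeasurableSet N) (hN0 : volume N = 0) :
    ω (N \ stieltjesBlowUpSet ω) = 0 := by
  have hzero : ∀ᵐ x ∂ω.restrict N, (volume : Measure ℝ).rnDeriv ω x = 0 := by
    refine (lintegral_eq_zero_iff (Measure.measurable_rnDeriv _ _)).1 ?_
    exact le_antisymm ((Measure.setLIntegral_rnDeriv_le N).trans hN0.le) zero_le
  rw [ae_restrict_iff' hN] at hzero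
  refine measure_mono_null ?_
    (hzero.and (Besicovitch.ae_tendsto_rnDeriv (volume : Measure ℝ) ω))
  rintro x ⟨hxN, hxS⟩ ⟨h0, hlim⟩
  refine hxS ?_
  rw [h0 hxN] at hlim
  rw [mem_stieltjesBlowUpSet_iff]
  have hinv : Tendsto (fun ε => ω (Metric.closedBall x ε) / volume (Metric.closedBall x ε))
      (𝓝[>] 0) (𝓝 ⊤) := by
    have h := hlim.inv
    rw [ENNReal.inv_zero] at h
    refine h.congr' ?_
    filter_upwards [self_mem_nhdsWithin] with ε hε
    refine ENNReal.inv_div (.inl (measure_ne_top _ _)) (.inr ?_)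
    simpa using hε
  rw [← ENNReal.tendsto_ofReal_nhds_top]
  refine tendsto_nhds_top_mono hinv ?_
  filter_upwards [self_mem_nhdsWithin] with ε hε
  have hε' : (0 : ℝ) < 2 * ε := mul_pos two_pos hε
  refine le_trans (le_of_eq ?_)
    (ENNReal.ofReal_le_ofReal (measure_closedBall_div_le_integral ω hε x))
  rw [Real.volume_closedBall, ENNReal.ofReal_div_of_pos hε', ofReal_measureReal]

/-- A positive semidefinite matrix-valued measure is absolutely continuous with respect to its
trace measure. -/
theorem entry_eq_zero_of_trace_measure_eq_zero {n : ℕ}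
    {Ω : Matrix (Fin n) (Fin n) (VectorMeasure ℝ ℂ)} {ω : Measure ℝ} {s : Set ℝ}
    (hpos : (Matrix.of fun i j => Ω i j s).PosSemidef)
    (hω : ω s = ENNReal.ofReal (∑ i, (Ω i i s).re)) (hs0 : ω s = 0) (i j : Fin n) :
    Ω i j s = 0 := by
  have htr := hpos.trace_nonneg
  rw [hs0, eq_comm, ENNReal.ofReal_eq_zero] at hω
  have htr0 : (Matrix.of fun i j => Ω i j s).trace = 0 := by
    obtain ⟨hre, him⟩ := Complex.le_def.1 htr
    refine Complex.ext (le_antisymm ?_ hre) him.symm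
    simpa [Matrix.trace] using hω
  exact congrFun (congrFun (hpos.trace_eq_zero_iff.1 htr0) i) j

/-- The singular part of a matrix-valued measure is its restriction to a Lebesgue null set. -/
theorem exists_null_set_singular_part {n : ℕ}
    {Ω Ωac Ωs : Matrix (Fin n) (Fin n) (VectorMeasure ℝ ℂ)}
    (hdecomp : ∀ i j, Ω i j = Ωac i j + Ωs i j)
    (hac : ∀ i j, Ωac i j ≪ᵥ volume.toENNRealVectorMeasure)
    (hsing : ∀ i j, Ωs i j ⟂ᵥ volume.toENNRealVectorMeasure) :
    ∃ N : Set ℝ, MeasurableSet N ∧ volume N = 0 ∧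
      ∀ t, MeasurableSet t → ∀ i j, Ωs i j t = Ω i j (N ∩ t) := by
  choose s hs hs0 hsv using hsing
  have hN : MeasurableSet (⋃ i, ⋃ j, (s i j)ᶜ) :=
    .iUnion fun i => .iUnion fun j => (hs i j).compl
  have hN0 : volume (⋃ i, ⋃ j, (s i j)ᶜ) = 0 :=
    measure_iUnion_null fun i => measure_iUnion_null fun j => by
      simpa [Measure.toENNRealVectorMeasure_apply_measurable (hs i j).compl]
        using hsv i j _ subset_rfl
  refine ⟨⋃ i, ⋃ j, (s i j)ᶜ, hN, hN0, fun t ht i j => ?_⟩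
  set N := ⋃ i, ⋃ j, (s i j)ᶜ
  have hNt : Ωac i j (N ∩ t) = 0 := by
    refine hac i j ?_
    rw [Measure.toENNRealVectorMeasure_apply_measurable (hN.inter ht)]
    exact measure_mono_null Set.inter_subset_left hN0
  have hdiff : Ωs i j (t \ N) = 0 := by
    refine hs0 i j _ fun x hx => ?_
    by_contra hxs
    exact hx.2 (Set.mem_iUnion₂.2 ⟨i, j, hxs⟩)
  rw [hdecomp, _root_.add_apply, hNt, zero_add, ← Set.inter_union_sdiff t N,
    VectorMeasure.of_union (Set.disjoint_sdiff_right.mono_left Set.inter_subset_right)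
      (ht.inter hN) (ht.diff hN), hdiff, add_zero, Set.inter_union_sdiff, Set.inter_comm]

/-- Let `Ω` be a matrix-valued Borel measure on `ℝ` with `Ω(Δ) ≥ 0`
for all Borel `Δ`, let `ω = trace Ω` be its (positive, finite) trace measure, and let
`M(z) = ∫ (t − z)⁻¹ dΩ(t)` on `ℂ₊`, so that
`trace Im M(λ + iε) = Im ∫ (t − (λ + iε))⁻¹ dω(t)`.
Let `Ω = Ω_ac + Ω_s` be the (entrywise) Lebesgue decomposition of `Ω` with respect to
Lebesgue measure.  Then the set
`S := { λ ∈ ℝ : lim_{ε→0⁺} trace Im M(λ + iε) = ∞ }`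
is a minimal support of the singular part `Ω_s`. -/
theorem statement5 (n : ℕ) (Ω Ωac Ωs : Matrix (Fin n) (Fin n) (VectorMeasure ℝ ℂ))
    (hpos : ∀ s : Set ℝ, MeasurableSet s → (Matrix.of fun i j => Ω i j s).PosSemidef)
    (hdecomp : ∀ i j, Ω i j = Ωac i j + Ωs i j)
    (hac : ∀ i j, Ωac i j ≪ᵥ volume.toENNRealVectorMeasure)
    (hsing : ∀ i j, Ωs i j ⟂ᵥ volume.toENNRealVectorMeasure)
    -- the trace measure `ω(Δ) = trace Ω(Δ)`
    (ω : Measure ℝ)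
    (hω : ∀ s : Set ℝ, MeasurableSet s → ω s = ENNReal.ofReal (∑ i, (Ω i i s).re)) :
    -- the set `S = S_{Ω,s}` where `trace Im M(λ + iε) → ∞` as `ε → 0⁺`
    MeasurableSet {l : ℝ | Tendsto
        (fun ε : ℝ => (∫ t, ((t : ℂ) - ((l : ℂ) + ε * Complex.I))⁻¹ ∂ω).im)
        (𝓝[>] 0) atTop} ∧
    (∀ i j, Ωs i j {l : ℝ | Tendsto
        (fun ε : ℝ => (∫ t, ((t : ℂ) - ((l : ℂ) + ε * Complex.I))⁻¹ ∂ω).im)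
        (𝓝[>] 0) atTop}ᶜ = 0) ∧
    ∀ T : Set ℝ, MeasurableSet T →
      T ⊆ {l : ℝ | Tendsto
        (fun ε : ℝ => (∫ t, ((t : ℂ) - ((l : ℂ) + ε * Complex.I))⁻¹ ∂ω).im)
        (𝓝[>] 0) atTop} →
      (∀ i j, Ωs i j Tᶜ = 0) →
      volume ({l : ℝ | Tendsto
        (fun ε : ℝ => (∫ t, ((t : ℂ) - ((l : ℂ) + ε * Complex.I))⁻¹ ∂ω).im)
        (𝓝[>] 0) atTop} \ T) = 0 := by
  have : IsFiniteMeasure ω := ⟨by rw [hω _ .univ]; exact ENNReal.ofReal_lt_top⟩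
  have hS := measurableSet_stieltjesBlowUpSet ω
  refine ⟨hS, fun i j => ?_,
    fun T _ _ _ => measure_mono_null Set.sdiff_subset (volume_stieltjesBlowUpSet ω)⟩
  obtain ⟨N, hN, hN0, hNs⟩ := exists_null_set_singular_part hdecomp hac hsing
  change Ωs i j (stieltjesBlowUpSet ω)ᶜ = 0
  have hNS := hN.inter hS.compl
  rw [hNs _ hS.compl]
  exact entry_eq_zero_of_trace_measure_eq_zero (hpos _ hNS) (hω _ hNS)
    (measure_sdiff_stieltjesBlowUpSet ω hN hN0) i j
end
end

section
/- Let Ω : 𝓑(ℝ) → ℂ^{n×n} be a matrix-valued measure with Ω(Δ) ≥ 0 (positive semidefinite) for all Borel sets Δ ⊂ ℝ, and let M(z) = ∫_ℝ (t − z)^{-1} dΩ(t) for z in the upper half-plane ℂ₊. Then the set S_{Ω,pp} := { λ ∈ ℝ : lim_{ε→0⁺} ε · trace M(λ + iε) ≠ 0 } is the smallest support of the pure point part Ω_pp of Ω, i.e. S_{Ω,pp} is exactly the set of atoms of Ω. -/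
open MeasureTheory Filter Topology Complex
open scoped InnerProductSpace ComplexOrder

noncomputable section

/-- For a finite Borel measure, `ε ∫ (t - (l + iε))⁻¹ dω(t)` tends to `i ω({l})` as `ε → 0⁺`. -/
theorem tendsto_mul_integral_resolvent (ω : Measure ℝ) [IsFiniteMeasure ω] (l : ℝ) :
    Tendsto (fun ε : ℝ => (ε : ℂ) * ∫ t, ((t : ℂ) - ((l : ℂ) + ε * Complex.I))⁻¹ ∂ω)
      (𝓝[>] 0) (𝓝 (ω.real {l} * Complex.I)) := by
  have hlim : ∫ t, ({l} : Set ℝ).indicator (fun _ => Complex.I) t ∂ω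
      = ω.real {l} * Complex.I := by
    rw [integral_indicator_const _ (measurableSet_singleton l), Complex.real_smul]
  rw [← hlim]
  simp_rw [← integral_const_mul]
  refine tendsto_integral_filter_of_dominated_convergence (fun _ => 1) ?_ ?_
    (integrable_const _) ?_
  · exact Eventually.of_forall fun ε => Measurable.aestronglyMeasurable (by fun_prop)
  · refine Eventually.of_forall fun ε => Eventually.of_forall fun t => ?_
    have him : |ε| ≤ ‖(t : ℂ) - ((l : ℂ) + ε * Complex.I)‖ := by
      simpa using Complex.abs_im_le_norm ((t : ℂ) - ((l : ℂ) + ε * Complex.I))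
    rw [norm_mul, norm_inv, Complex.norm_real, Real.norm_eq_abs, ← div_eq_mul_inv]
    exact div_le_one_of_le₀ him (norm_nonneg _)
  · refine Eventually.of_forall fun t => ?_
    by_cases ht : t = l
    · subst ht
      refine tendsto_const_nhds.congr' ?_
      filter_upwards [self_mem_nhdsWithin] with ε (hε : 0 < ε)
      have hε' : (ε : ℂ) ≠ 0 := by exact_mod_cast hε.ne'
      simp [mul_left_comm, hε']
    · have ht' : (t : ℂ) - l ≠ 0 := sub_ne_zero.2 (by exact_mod_cast ht)
      have hcont : ContinuousAt
          (fun ε : ℝ => (ε : ℂ) * ((t : ℂ) - ((l : ℂ) + ε * Complex.I))⁻¹) 0 :=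
        ContinuousAt.mul (by fun_prop) (ContinuousAt.inv₀ (by fun_prop) (by simpa using ht'))
      simpa [ht] using hcont.tendsto.mono_left nhdsWithin_le_nhds

/-- Let `Ω` be a matrix-valued Borel measure on `ℝ` with `Ω(Δ) ≥ 0`
for all Borel `Δ`, let `ω = trace Ω` be its trace measure, and let
`M(z) = ∫ (t − z)⁻¹ dΩ(t)` on `ℂ₊`, so that
`trace M(λ + iε) = ∫ (t − (λ + iε))⁻¹ dω(t)`.
Then the set `S_{Ω,pp} := { λ ∈ ℝ : lim_{ε→0⁺} ε · trace M(λ + iε) ≠ 0 }` is the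
smallest support of the pure point part of `Ω`, i.e. it is exactly the set of atoms
of `Ω` (the points `λ` with `Ω({λ}) ≠ 0`). -/
theorem statement6 (n : ℕ) (Ω : Matrix (Fin n) (Fin n) (VectorMeasure ℝ ℂ))
    (hpos : ∀ s : Set ℝ, MeasurableSet s → (Matrix.of fun i j => Ω i j s).PosSemidef)
    -- the trace measure `ω(Δ) = trace Ω(Δ)`
    (ω : Measure ℝ)
    (hω : ∀ s : Set ℝ, MeasurableSet s → ω s = ENNReal.ofReal (∑ i, (Ω i i s).re)) :
    {l : ℝ | ¬ Tendsto
        (fun ε : ℝ => (ε : ℂ) * ∫ t, ((t : ℂ) - ((l : ℂ) + ε * Complex.I))⁻¹ ∂ω)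
        (𝓝[>] 0) (𝓝 0)}
      = {l : ℝ | (Matrix.of fun i j => Ω i j {l}) ≠ 0} := by
  have : IsFiniteMeasure ω := ⟨by rw [hω _ .univ]; exact ENNReal.ofReal_lt_top⟩
  ext l
  have hps := hpos {l} (measurableSet_singleton l)
  have hlim := tendsto_mul_integral_resolvent ω l
  have htr : 0 ≤ (Matrix.of fun i j => Ω i j {l}).trace := hps.trace_nonneg
  have hre : (∑ i, (Ω i i {l}).re) = (Matrix.of fun i j => Ω i j {l}).trace.re := by
    simp [Matrix.trace]
  have hzero : ω.real {l} = 0 ↔ (Matrix.of fun i j => Ω i j {l}) = 0 := by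
    rw [← hps.trace_eq_zero_iff, measureReal_eq_zero_iff,
      hω _ (measurableSet_singleton l), hre, ENNReal.ofReal_eq_zero]
    obtain ⟨h₁, h₂⟩ := Complex.nonneg_iff.1 htr
    exact ⟨fun h => Complex.ext (le_antisymm h h₁) h₂.symm, fun h => by rw [h]; rfl⟩
  rw [Set.mem_ofPred_eq, Set.mem_ofPred_eq, Ne, ← hzero, not_iff_not]
  refine ⟨fun h => ?_, fun h => by simpa [h] using hlim⟩
  simpa using tendsto_nhds_unique hlim h
end
end
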